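/- Let σ be continuously differentiable and positive on an open neighborhood of the closed unit square, and let (u, U) be a classical CEM solution for σ with impedances z₀, z₁ > 0 and currents I₀, I₁. Then I₀ + I₁ = 0, and for every v continuously differentiable on an open neighborhood of the closed square and every V = (V₀,V₁) ∈ ℝ² with V₀ + V₁ = 0, the Euler–Lagrange identity holds: ∫_Ω σ∇u·∇v dxdy + (1/z₀)∫₀¹(u(x,0)−U₀)(v(x,0)−V₀) dx + (1/z₁)∫₀¹(u(x,1)−U₁)(v(x,1)−V₁) dx − I₀V₀ − I₁V₁ = 0. -/

import Mathlib

open MeasureTheory Set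

/-- Partial derivative in the first (x) variable. -/
noncomputable def pdx (u : ℝ × ℝ → ℝ) (p : ℝ × ℝ) : ℝ :=
  deriv (fun t => u (t, p.2)) p.1

/-- Partial derivative in the second (y) variable. -/
noncomputable def pdy (u : ℝ × ℝ → ℝ) (p : ℝ × ℝ) : ℝ :=
  deriv (fun t => u (p.1, t)) p.2

/-- Euclidean norm of the gradient `|∇u|`. -/
noncomputable def gradNorm (u : ℝ × ℝ → ℝ) (p : ℝ × ℝ) : ℝ :=
  Real.sqrt ((pdx u p) ^ 2 + (pdy u p) ^ 2)

/-- The closed unit square `[0,1] × [0,1]`. -/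
def SQ : Set (ℝ × ℝ) := Icc (0 : ℝ) 1 ×ˢ Icc (0 : ℝ) 1

/-- The open unit square `(0,1) × (0,1)`. -/
def SQo : Set (ℝ × ℝ) := Ioo (0 : ℝ) 1 ×ˢ Ioo (0 : ℝ) 1

/-- `v` is continuously differentiable on an open neighborhood of the closed unit square. -/
def C1Nbhd (v : ℝ × ℝ → ℝ) : Prop :=
  ∃ W : Set (ℝ × ℝ), IsOpen W ∧ SQ ⊆ W ∧ ContDiffOn ℝ 1 v W

/-- A classical solution `(u, (U₀, U₁))` of the Complete Electrode Model on the unit square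
for the conductivity `σ`, constant impedances `z₀, z₁` (bottom/top electrodes) and
input currents `I₀, I₁`. -/
structure IsCEMSolution (σ u : ℝ × ℝ → ℝ) (U₀ U₁ z₀ z₁ I₀ I₁ : ℝ) : Prop where
  smooth : ∃ W : Set (ℝ × ℝ), IsOpen W ∧ SQ ⊆ W ∧ ContDiffOn ℝ 2 u W
  ground : U₀ + U₁ = 0
  pde : ∀ p ∈ SQo,
    pdx (fun q => σ q * pdx u q) p + pdy (fun q => σ q * pdy u q) p = 0
  robin_bot : ∀ x ∈ Icc (0 : ℝ) 1, u (x, 0) - z₀ * σ (x, 0) * pdy u (x, 0) = U₀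
  robin_top : ∀ x ∈ Icc (0 : ℝ) 1, u (x, 1) + z₁ * σ (x, 1) * pdy u (x, 1) = U₁
  flux_bot : (∫ x in (0 : ℝ)..1, -(σ (x, 0) * pdy u (x, 0))) = I₀
  flux_top : (∫ x in (0 : ℝ)..1, σ (x, 1) * pdy u (x, 1)) = I₁
  noflux_left : ∀ y ∈ Icc (0 : ℝ) 1, pdx u (0, y) = 0
  noflux_right : ∀ y ∈ Icc (0 : ℝ) 1, pdx u (1, y) = 0

/-- The weighted least-gradient functional `G_a` with CEM boundary terms. -/
noncomputable def Gfun (a : ℝ × ℝ → ℝ) (z₀ z₁ I₀ I₁ : ℝ) (v : ℝ × ℝ → ℝ)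
    (V₀ V₁ : ℝ) : ℝ :=
  (∫ p in SQo, a p * gradNorm v p)
    + (1 / (2 * z₀)) * (∫ x in (0 : ℝ)..1, (v (x, 0) - V₀) ^ 2)
    + (1 / (2 * z₁)) * (∫ x in (0 : ℝ)..1, (v (x, 1) - V₁) ^ 2)
    - I₀ * V₀ - I₁ * V₁

/-- The CEM energy functional `F_σ`. -/
noncomputable def Ffun (σ : ℝ × ℝ → ℝ) (z₀ z₁ I₀ I₁ : ℝ) (v : ℝ × ℝ → ℝ)
    (V₀ V₁ : ℝ) : ℝ :=
  (1 / 2) * (∫ p in SQo, σ p * ((pdx v p) ^ 2 + (pdy v p) ^ 2))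
    + (1 / (2 * z₀)) * (∫ x in (0 : ℝ)..1, (v (x, 0) - V₀) ^ 2)
    + (1 / (2 * z₁)) * (∫ x in (0 : ℝ)..1, (v (x, 1) - V₁) ^ 2)
    - I₀ * V₀ - I₁ * V₁

theorem SQo_subset_SQ : SQo ⊆ SQ :=
  prod_mono Ioo_subset_Icc_self Ioo_subset_Icc_self

theorem HasFDerivAt.pdx_eq {u : ℝ × ℝ → ℝ} {u' : ℝ × ℝ →L[ℝ] ℝ} {p : ℝ × ℝ}
    (h : HasFDerivAt u u' p) : pdx u p = u' (1, 0) :=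
  (HasFDerivAt.comp_hasDerivAt (f := fun t : ℝ => (t, p.2)) p.1 h
    ((hasDerivAt_id p.1).prodMk (hasDerivAt_const p.1 p.2))).deriv

theorem HasFDerivAt.pdy_eq {u : ℝ × ℝ → ℝ} {u' : ℝ × ℝ →L[ℝ] ℝ} {p : ℝ × ℝ}
    (h : HasFDerivAt u u' p) : pdy u p = u' (0, 1) :=
  (HasFDerivAt.comp_hasDerivAt (f := fun t : ℝ => (p.1, t)) p.2 h
    ((hasDerivAt_const p.2 p.1).prodMk (hasDerivAt_id p.2))).deriv

theorem pdx_mul {f g : ℝ × ℝ → ℝ} {p : ℝ × ℝ} (hf : DifferentiableAt ℝ f p)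
    (hg : DifferentiableAt ℝ g p) :
    pdx (fun q => f q * g q) p = f p * pdx g p + g p * pdx f p := by
  rw [show pdx (fun q => f q * g q) p = _ from (hf.hasFDerivAt.mul hg.hasFDerivAt).pdx_eq,
    hf.hasFDerivAt.pdx_eq, hg.hasFDerivAt.pdx_eq]
  simp

theorem pdy_mul {f g : ℝ × ℝ → ℝ} {p : ℝ × ℝ} (hf : DifferentiableAt ℝ f p)
    (hg : DifferentiableAt ℝ g p) :
    pdy (fun q => f q * g q) p = f p * pdy g p + g p * pdy f p := by
  rw [show pdy (fun q => f q * g q) p = _ from (hf.hasFDerivAt.mul hg.hasFDerivAt).pdy_eq,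
    hf.hasFDerivAt.pdy_eq, hg.hasFDerivAt.pdy_eq]
  simp

namespace C1Nbhd

variable {f g : ℝ × ℝ → ℝ}

theorem differentiableAt (hf : C1Nbhd f) {p : ℝ × ℝ} (hp : p ∈ SQ) : DifferentiableAt ℝ f p := by
  obtain ⟨W, hW, hS, h⟩ := hf
  exact (h.contDiffAt (hW.mem_nhds (hS hp))).differentiableAt one_ne_zero

theorem continuousOn (hf : C1Nbhd f) : ContinuousOn f SQ := fun _ hp =>
  (hf.differentiableAt hp).continuousAt.continuousWithinAt

theorem continuousOn_fderiv (hf : C1Nbhd f) : ContinuousOn (fderiv ℝ f) SQ := by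
  obtain ⟨W, hW, hS, h⟩ := hf
  exact (h.continuousOn_fderiv_of_isOpen hW le_rfl).mono hS

theorem mul (hf : C1Nbhd f) (hg : C1Nbhd g) : C1Nbhd (fun p => f p * g p) := by
  obtain ⟨W, hW, hS, h⟩ := hf
  obtain ⟨W', hW', hS', h'⟩ := hg
  exact ⟨W ∩ W', hW.inter hW', subset_inter hS hS',
    (h.mono inter_subset_left).mul (h'.mono inter_subset_right)⟩

theorem intervalIntegrable_horizontal (hf : C1Nbhd f) {y : ℝ} (hy : y ∈ Icc (0 : ℝ) 1) :
    IntervalIntegrable (fun x => f (x, y)) volume 0 1 := by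
  refine ContinuousOn.intervalIntegrable ?_
  rw [uIcc_of_le zero_le_one]
  exact hf.continuousOn.comp (by fun_prop) fun x hx => mk_mem_prod hx hy

/-- The divergence theorem on the unit square. -/
theorem integral_divergence (hf : C1Nbhd f) (hg : C1Nbhd g) :
    (∫ p in SQo, (pdx f p + pdy g p)) =
      (∫ x in (0 : ℝ)..1, g (x, 1)) - (∫ x in (0 : ℝ)..1, g (x, 0))
        + (∫ y in (0 : ℝ)..1, f (1, y)) - ∫ y in (0 : ℝ)..1, f (0, y) := by
  have hSQ : Icc ((0 : ℝ), (0 : ℝ)) (1, 1) = SQ := (Icc_prod_Icc _ _ _ _).symm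
  have hae : SQo =ᵐ[volume] SQ := by
    rw [Measure.volume_eq_prod]
    exact Measure.set_prod_ae_eq Ioo_ae_eq_Icc Ioo_ae_eq_Icc
  have key := integral_divergence_prod_Icc_of_hasFDerivAt_of_le f g (fderiv ℝ f) (fderiv ℝ g)
    (0, 0) (1, 1) (by simp) (hSQ ▸ hf.continuousOn) (hSQ ▸ hg.continuousOn)
    (fun p hp => (hf.differentiableAt (SQo_subset_SQ hp)).hasFDerivAt)
    (fun p hp => (hg.differentiableAt (SQo_subset_SQ hp)).hasFDerivAt)
    (ContinuousOn.integrableOn_compact isCompact_Icc (by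
      rw [hSQ]
      exact (hf.continuousOn_fderiv.clm_apply continuousOn_const).add
        (hg.continuousOn_fderiv.clm_apply continuousOn_const)))
  rw [← key, hSQ, setIntegral_congr_set hae]
  refine setIntegral_congr_fun (measurableSet_Icc.prod measurableSet_Icc) fun p hp => ?_
  simp only [(hf.differentiableAt hp).hasFDerivAt.pdx_eq,
    (hg.differentiableAt hp).hasFDerivAt.pdy_eq]

end C1Nbhd

theorem C1Nbhd.const (c : ℝ) : C1Nbhd fun _ => c :=
  ⟨univ, isOpen_univ, subset_univ _, contDiffOn_const⟩

theorem ContDiffOn.c1Nbhd_pdx {u : ℝ × ℝ → ℝ} {W : Set (ℝ × ℝ)} (hW : IsOpen W) (hS : SQ ⊆ W)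
    (hu : ContDiffOn ℝ 2 u W) : C1Nbhd (pdx u) := by
  refine ⟨W, hW, hS, ContDiffOn.congr (f := fun p => fderiv ℝ u p (1, 0)) ?_ fun p hp => ?_⟩
  · exact (hu.fderiv_of_isOpen hW (by norm_num)).clm_apply contDiffOn_const
  · exact ((hu.contDiffAt (hW.mem_nhds hp)).differentiableAt two_ne_zero).hasFDerivAt.pdx_eq

theorem ContDiffOn.c1Nbhd_pdy {u : ℝ × ℝ → ℝ} {W : Set (ℝ × ℝ)} (hW : IsOpen W) (hS : SQ ⊆ W)
    (hu : ContDiffOn ℝ 2 u W) : C1Nbhd (pdy u) := by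
  refine ⟨W, hW, hS, ContDiffOn.congr (f := fun p => fderiv ℝ u p (0, 1)) ?_ fun p hp => ?_⟩
  · exact (hu.fderiv_of_isOpen hW (by norm_num)).clm_apply contDiffOn_const
  · exact ((hu.contDiffAt (hW.mem_nhds hp)).differentiableAt two_ne_zero).hasFDerivAt.pdy_eq

namespace IsCEMSolution

variable {σ u v : ℝ × ℝ → ℝ} {U₀ U₁ z₀ z₁ I₀ I₁ : ℝ}

/-- Green's identity for a classical CEM solution. -/
theorem integral_grad_mul_grad (hσ : C1Nbhd σ) (h : IsCEMSolution σ u U₀ U₁ z₀ z₁ I₀ I₁)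
    (hv : C1Nbhd v) :
    (∫ p in SQo, σ p * (pdx u p * pdx v p + pdy u p * pdy v p)) =
      (∫ x in (0 : ℝ)..1, σ (x, 1) * pdy u (x, 1) * v (x, 1))
        - ∫ x in (0 : ℝ)..1, σ (x, 0) * pdy u (x, 0) * v (x, 0) := by
  obtain ⟨W, hW, hS, hu⟩ := h.smooth
  have hx : C1Nbhd fun p => σ p * pdx u p := hσ.mul (hu.c1Nbhd_pdx hW hS)
  have hy : C1Nbhd fun p => σ p * pdy u p := hσ.mul (hu.c1Nbhd_pdy hW hS)
  have hleft : (∫ y in (0 : ℝ)..1, σ (0, y) * pdx u (0, y) * v (0, y)) = 0 := by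
    refine intervalIntegral.integral_zero_ae (Filter.Eventually.of_forall fun y hy => ?_)
    rw [uIoc_of_le zero_le_one] at hy
    simp [h.noflux_left y (Ioc_subset_Icc_self hy)]
  have hright : (∫ y in (0 : ℝ)..1, σ (1, y) * pdx u (1, y) * v (1, y)) = 0 := by
    refine intervalIntegral.integral_zero_ae (Filter.Eventually.of_forall fun y hy => ?_)
    rw [uIoc_of_le zero_le_one] at hy
    simp [h.noflux_right y (Ioc_subset_Icc_self hy)]
  have key := (hx.mul hv).integral_divergence (hy.mul hv)
  rw [hleft, hright, add_zero, sub_zero] at key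
  rw [← key]
  refine setIntegral_congr_fun (measurableSet_Ioo.prod measurableSet_Ioo) fun p hp => ?_
  have hp' := SQo_subset_SQ hp
  have hvd := hv.differentiableAt hp'
  simp only [pdx_mul (hx.differentiableAt hp') hvd, pdy_mul (hy.differentiableAt hp') hvd]
  linear_combination -v p * h.pde p hp

theorem current_add_current (hσ : C1Nbhd σ) (h : IsCEMSolution σ u U₀ U₁ z₀ z₁ I₀ I₁) :
    I₀ + I₁ = 0 := by
  have key := h.integral_grad_mul_grad hσ (.const 1)
  have hbot := h.flux_bot
  rw [intervalIntegral.integral_neg] at hbot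
  simp only [pdx, pdy, deriv_const, mul_zero, add_zero, integral_zero, mul_one] at key
  have htop := h.flux_top
  simp only [pdy] at hbot htop
  linarith

end IsCEMSolution

/-- A classical CEM solution satisfies the conservation of charge `I₀ + I₁ = 0` and the
Euler–Lagrange identity (vanishing Gâteaux derivative of `F_σ`) in every direction `(v, V)`. -/
theorem cem_solution_euler_lagrange (σ u : ℝ × ℝ → ℝ) (U₀ U₁ z₀ z₁ I₀ I₁ : ℝ)
    (hσ : ∃ W : Set (ℝ × ℝ), IsOpen W ∧ SQ ⊆ W ∧ ContDiffOn ℝ 1 σ W)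
    (hσpos : ∀ p ∈ SQ, 0 < σ p)
    (hz₀ : 0 < z₀) (hz₁ : 0 < z₁)
    (hsol : IsCEMSolution σ u U₀ U₁ z₀ z₁ I₀ I₁) :
    I₀ + I₁ = 0 ∧
    ∀ v : ℝ × ℝ → ℝ, C1Nbhd v → ∀ V₀ V₁ : ℝ, V₀ + V₁ = 0 →
      (∫ p in SQo, σ p * (pdx u p * pdx v p + pdy u p * pdy v p))
        + (1 / z₀) * (∫ x in (0 : ℝ)..1, (u (x, 0) - U₀) * (v (x, 0) - V₀))
        + (1 / z₁) * (∫ x in (0 : ℝ)..1, (u (x, 1) - U₁) * (v (x, 1) - V₁))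
        - I₀ * V₀ - I₁ * V₁ = 0 := by
  refine ⟨hsol.current_add_current hσ, fun v hv V₀ V₁ _ => ?_⟩
  obtain ⟨W, hW, hS, hu⟩ := hsol.smooth
  have hy : C1Nbhd fun p => σ p * pdy u p := C1Nbhd.mul hσ (hu.c1Nbhd_pdy hW hS)
  have hyv := hy.mul hv
  have h0 : (0 : ℝ) ∈ Icc (0 : ℝ) 1 := by simp
  have h1 : (1 : ℝ) ∈ Icc (0 : ℝ) 1 := by simp
  have hbot : (1 / z₀) * (∫ x in (0 : ℝ)..1, (u (x, 0) - U₀) * (v (x, 0) - V₀)) =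
      (∫ x in (0 : ℝ)..1, σ (x, 0) * pdy u (x, 0) * v (x, 0)) + I₀ * V₀ := by
    rw [← hsol.flux_bot, intervalIntegral.integral_neg, neg_mul, ← sub_eq_add_neg,
      ← intervalIntegral.integral_mul_const, ← intervalIntegral.integral_const_mul,
      ← intervalIntegral.integral_sub (hyv.intervalIntegrable_horizontal h0)
        ((hy.intervalIntegrable_horizontal h0).mul_const V₀)]
    refine intervalIntegral.integral_congr fun x hx => ?_
    rw [uIcc_of_le zero_le_one] at hx
    have hr : u (x, 0) - U₀ = z₀ * (σ (x, 0) * pdy u (x, 0)) := by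
      linarith [hsol.robin_bot x hx]
    simp only [hr]
    field_simp
  have htop : (1 / z₁) * (∫ x in (0 : ℝ)..1, (u (x, 1) - U₁) * (v (x, 1) - V₁)) =
      I₁ * V₁ - ∫ x in (0 : ℝ)..1, σ (x, 1) * pdy u (x, 1) * v (x, 1) := by
    rw [← hsol.flux_top,
      ← intervalIntegral.integral_mul_const, ← intervalIntegral.integral_const_mul,
      ← intervalIntegral.integral_sub ((hy.intervalIntegrable_horizontal h1).mul_const V₁)
        (hyv.intervalIntegrable_horizontal h1)]
    refine intervalIntegral.integral_congr fun x hx => ?_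
    rw [uIcc_of_le zero_le_one] at hx
    have hr : u (x, 1) - U₁ = -(z₁ * (σ (x, 1) * pdy u (x, 1))) := by
      linarith [hsol.robin_top x hx]
    simp only [hr]
    field_simp
    ring
  rw [hsol.integral_grad_mul_grad hσ hv, hbot, htop]
  ring
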